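/- Let G be a hereditary modular graph with vertices ∗ and v such that the interval I(∗,v) is K_{2,3}-free. Then every vertex w ∈ I(∗,v) with w ≠ ∗ has at least one and at most two neighbours x ∈ I(∗,v) with d(∗,x) = d(∗,w) − 1; that is, 1 ≤ ρ(w) ≤ 2 for all w ∈ I(∗,v) \ {∗}. -/

import Mathlib

/-- A connected graph is modular if every triple of vertices has a median. -/
def Modular {W : Type*} (G : SimpleGraph W) : Prop :=
  G.Connected ∧ ∀ u v w : W, ∃ m : W,
    G.dist u m + G.dist m v = G.dist u v ∧
    G.dist u m + G.dist m w = G.dist u w ∧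
    G.dist v m + G.dist m w = G.dist v w

/-- A connected graph is hereditary modular if every connected isometric subgraph
of it is modular. -/
def HereditaryModular {V : Type*} (G : SimpleGraph V) : Prop :=
  G.Connected ∧ ∀ H : G.Subgraph, H.Connected →
    (∀ x y : H.verts, H.coe.dist x y = G.dist x.1 y.1) → Modular H.coe

/-- The interval `I(u,v)`: the set of vertices lying on geodesics from `u` to `v`. -/
def interval {V : Type*} (G : SimpleGraph V) (u v : V) : Set V :=
  {w | G.dist u w + G.dist w v = G.dist u v}

/-- A graph is `K_{2,3}`-free if there are no five distinct vertices
`a₀, a₁, b₀, b₁, b₂` with `aᵢ` adjacent to `bⱼ` for all `i`, `j`. -/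
def K23Free {W : Type*} (G : SimpleGraph W) : Prop :=
  ¬ ∃ a₀ a₁ b₀ b₁ b₂ : W, a₀ ≠ a₁ ∧ b₀ ≠ b₁ ∧ b₀ ≠ b₂ ∧ b₁ ≠ b₂ ∧
    G.Adj a₀ b₀ ∧ G.Adj a₀ b₁ ∧ G.Adj a₀ b₂ ∧
    G.Adj a₁ b₀ ∧ G.Adj a₁ b₁ ∧ G.Adj a₁ b₂

/-- `rho G b v w` is the number of vertices `x ∈ I(b,v)` adjacent to `w` with
`d(b,x) = d(b,w) - 1`. -/
noncomputable def rho {V : Type*} (G : SimpleGraph V) (b v w : V) : ℕ :=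
  {x | x ∈ interval G b v ∧ G.Adj w x ∧ G.dist b x + 1 = G.dist b w}.ncard

namespace SimpleGraph

variable {V : Type*} {G : SimpleGraph V}

theorem Connected.exists_adj_dist_add_one (hG : G.Connected) {u v : V} (h : u ≠ v) :
    ∃ w, G.Adj u w ∧ G.dist w v + 1 = G.dist u v := by
  obtain ⟨p, hp⟩ := hG.exists_walk_length_eq_dist u v
  cases p with
  | nil => exact absurd rfl h
  | @cons _ w _ huw q =>
    refine ⟨w, huw, ?_⟩
    have h₁ := dist_le q
    have h₂ := hG.dist_triangle (u := u) (v := w) (w := v)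
    rw [dist_eq_one_iff_adj.mpr huw] at h₂
    rw [Walk.length_cons] at hp
    omega

theorem exists_walk_induce_length_eq_dist (hG : G.Connected) {S : Set V}
    (hS : ∀ x ∈ S, ∀ y ∈ S, x ≠ y → ∃ z ∈ S, G.Adj x z ∧ G.dist z y + 1 = G.dist x y)
    (x y : S) :
    ∃ p : (G.induce S).Walk x y, p.length = G.dist x.1 y.1 := by
  obtain ⟨n, hn⟩ : ∃ n, G.dist x.1 y.1 = n := ⟨_, rfl⟩
  induction n generalizing x with
  | zero =>
    obtain rfl : x = y := Subtype.ext (hG.dist_eq_zero_iff.mp hn)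
    exact ⟨Walk.nil, by simp⟩
  | succ n ih =>
    have hxy : x.1 ≠ y.1 := fun h => by simp [h] at hn
    obtain ⟨z, hzS, hxz, hz⟩ := hS x x.2 y y.2 hxy
    obtain ⟨p, hp⟩ := ih ⟨z, hzS⟩ (by simp only; omega)
    have hadj : (G.induce S).Adj x ⟨z, hzS⟩ := hxz
    exact ⟨Walk.cons hadj p, by rw [Walk.length_cons, hp, hz]⟩

end SimpleGraph

section

variable {V : Type*} {G : SimpleGraph V}

/-- If from any vertex of `S` one can always move inside `S` one step closer to any other vertex
of `S`, then the subgraph induced on `S` is isometric, hence modular. -/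
theorem HereditaryModular.exists_median_mem (hG : HereditaryModular G) {S : Set V}
    (hne : S.Nonempty)
    (hS : ∀ x ∈ S, ∀ y ∈ S, x ≠ y → ∃ z ∈ S, G.Adj x z ∧ G.dist z y + 1 = G.dist x y)
    {u v w : V} (hu : u ∈ S) (hv : v ∈ S) (hw : w ∈ S) :
    ∃ m ∈ S, G.dist u m + G.dist m v = G.dist u v ∧
      G.dist u m + G.dist m w = G.dist u w ∧
      G.dist v m + G.dist m w = G.dist v w := by
  let H : G.Subgraph := (⊤ : G.Subgraph).induce S
  have hle : G.induce S ≤ H.coe := by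
    intro x y hxy
    exact ⟨x.2, y.2, hxy⟩
  have hwalk : ∀ x y : H.verts, ∃ p : H.coe.Walk x y, p.length = G.dist x.1 y.1 := by
    intro x y
    obtain ⟨p, hp⟩ := SimpleGraph.exists_walk_induce_length_eq_dist hG.1 hS x y
    exact ⟨p.mapLe hle, by rw [← hp]; exact SimpleGraph.Walk.length_map _ _⟩
  have hconn : H.coe.Connected :=
    { preconnected := fun x y => (hwalk x y).choose.reachable
      nonempty := hne.to_subtype }
  have hdist : ∀ x y : H.verts, H.coe.dist x y = G.dist x.1 y.1 := by
    intro x y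
    apply le_antisymm
    · obtain ⟨p, hp⟩ := hwalk x y
      exact hp ▸ SimpleGraph.dist_le p
    · obtain ⟨p, hp⟩ := hconn.exists_walk_length_eq_dist x y
      rw [← hp, ← SimpleGraph.Walk.length_map H.hom p]
      exact SimpleGraph.dist_le _
  obtain ⟨m, hm⟩ := (hG.2 H ⟨hconn⟩ hdist).2 ⟨u, hu⟩ ⟨v, hv⟩ ⟨w, hw⟩
  simp only [hdist] at hm
  exact ⟨m.1, m.2, hm⟩

theorem HereditaryModular.modular (hG : HereditaryModular G) : Modular G := by
  refine ⟨hG.1, fun u v w => ?_⟩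
  obtain ⟨m, -, hm⟩ := hG.exists_median_mem (S := Set.univ) ⟨u, trivial⟩
    (fun x _ y _ hxy => by
      obtain ⟨z, hz⟩ := hG.1.exists_adj_dist_add_one hxy
      exact ⟨z, trivial, hz⟩) (u := u) (v := v) (w := w) trivial trivial trivial
  exact ⟨m, hm⟩

theorem Modular.even_dist_add_dist_add_dist (hG : Modular G) (u v w : V) :
    Even (G.dist u v + G.dist v w + G.dist u w) := by
  obtain ⟨m, h₁, h₂, h₃⟩ := hG.2 u v w
  refine ⟨G.dist u m + G.dist v m + G.dist m w, ?_⟩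
  rw [G.dist_comm (u := m) (v := v)] at h₁
  omega

theorem Modular.dist_eq_two (hG : Modular G) {x y z : V} (hx : G.Adj z x) (hy : G.Adj z y)
    (hxy : x ≠ y) : G.dist x y = 2 := by
  obtain ⟨k, hk⟩ := hG.even_dist_add_dist_add_dist x z y
  have h₁ := SimpleGraph.dist_eq_one_iff_adj.mpr hx.symm
  have h₂ := SimpleGraph.dist_eq_one_iff_adj.mpr hy
  have h₃ := hG.1.dist_triangle (u := x) (v := z) (w := y)
  have h₄ := hG.1.pos_dist_of_ne hxy
  omega

/-- Two neighbours of `w` one step closer to `b` have a common neighbour another step closer. -/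
theorem Modular.exists_adj_adj_dist_add_one (hG : Modular G) {b w x y : V}
    (hx : G.Adj w x) (hy : G.Adj w y) (hxy : x ≠ y) (h : G.dist b x = G.dist b y) :
    ∃ z, G.Adj x z ∧ G.Adj y z ∧ G.dist b z + 1 = G.dist b x := by
  have h₂ := hG.dist_eq_two hx hy hxy
  obtain ⟨m, h₃, h₄, h₅⟩ := hG.2 b x y
  rw [G.dist_comm (u := m) (v := x)] at h₃
  rw [G.dist_comm (u := m) (v := y)] at h₄ h₅
  refine ⟨m, ?_, ?_, by omega⟩ <;> rw [← SimpleGraph.dist_eq_one_iff_adj] <;> omega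

theorem Modular.dist_eq_three (hG : Modular G) {x y z : V} (hxy : G.dist x y = 2)
    (hyz : G.Adj y z) (hxz : ¬ G.Adj x z) :
    G.dist x z = 3 := by
  obtain ⟨k, hk⟩ := hG.even_dist_add_dist_add_dist x y z
  have h₁ := SimpleGraph.dist_eq_one_iff_adj.mpr hyz
  have h₂ := hG.1.dist_triangle (u := x) (v := y) (w := z)
  have h₃ : G.dist x z ≠ 1 := fun h => hxz (SimpleGraph.dist_eq_one_iff_adj.mp h)
  omega

/-- A 6-cycle `x₁ c x₂ a x₃ b` in a hereditary modular graph has a chord. -/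
theorem HereditaryModular.exists_chord_of_six_cycle (hG : HereditaryModular G)
    {x₁ x₂ x₃ a b c : V} (hx₁₂ : x₁ ≠ x₂) (hx₁₃ : x₁ ≠ x₃) (hx₂₃ : x₂ ≠ x₃)
    (hab : a ≠ b) (hac : a ≠ c) (hbc : b ≠ c)
    (h₁b : G.Adj x₁ b) (h₁c : G.Adj x₁ c) (h₂a : G.Adj x₂ a) (h₂c : G.Adj x₂ c)
    (h₃a : G.Adj x₃ a) (h₃b : G.Adj x₃ b) :
    G.Adj x₁ a ∨ G.Adj x₂ b ∨ G.Adj x₃ c := by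
  by_contra! ⟨n₁, n₂, n₃⟩
  have hM := hG.modular
  have d₁₂ := hM.dist_eq_two h₁c.symm h₂c.symm hx₁₂
  have d₁₃ := hM.dist_eq_two h₁b.symm h₃b.symm hx₁₃
  have d₂₃ := hM.dist_eq_two h₂a.symm h₃a.symm hx₂₃
  have dab := hM.dist_eq_two h₃a h₃b hab
  have dac := hM.dist_eq_two h₂a h₂c hac
  have dbc := hM.dist_eq_two h₁b h₁c hbc
  have d₁a := hM.dist_eq_three d₁₂ h₂a n₁
  have d₂b := hM.dist_eq_three (G.dist_comm.trans d₁₂) h₁b n₂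
  have d₃c := hM.dist_eq_three (G.dist_comm.trans d₁₃) h₁c n₃
  have e₁b := SimpleGraph.dist_eq_one_iff_adj.mpr h₁b
  have e₁c := SimpleGraph.dist_eq_one_iff_adj.mpr h₁c
  have e₂a := SimpleGraph.dist_eq_one_iff_adj.mpr h₂a
  have e₂c := SimpleGraph.dist_eq_one_iff_adj.mpr h₂c
  have e₃a := SimpleGraph.dist_eq_one_iff_adj.mpr h₃a
  have e₃b := SimpleGraph.dist_eq_one_iff_adj.mpr h₃b
  have hcomm : ∀ u v, G.dist u v = G.dist v u := fun _ _ => G.dist_comm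
  obtain ⟨m, hm, h₁, h₂, h₃⟩ := hG.exists_median_mem
    (S := {x₁, x₂, x₃, a, b, c}) ⟨x₁, by simp⟩ (by
      intro x hx y hy hxy
      simp only [Set.mem_insert_iff, Set.mem_singleton_iff] at hx hy
      simp only [Set.mem_insert_iff, Set.mem_singleton_iff, exists_eq_or_imp, exists_eq_left,
        ← SimpleGraph.dist_eq_one_iff_adj]
      rcases hx with rfl | rfl | rfl | rfl | rfl | rfl <;>
      rcases hy with rfl | rfl | rfl | rfl | rfl | rfl <;> grind)
    (u := x₁) (v := x₂) (w := x₃) (by simp) (by simp) (by simp)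
  rw [hcomm m] at h₁ h₂ h₃
  simp only [Set.mem_insert_iff, Set.mem_singleton_iff] at hm
  rcases hm with rfl | rfl | rfl | rfl | rfl | rfl <;> grind

theorem mem_interval_of_adj (hG : G.Connected) {b v x y : V} (hx : x ∈ interval G b v)
    (hxy : G.Adj x y) (h : G.dist b y + 1 = G.dist b x) : y ∈ interval G b v := by
  have h₁ := hG.dist_triangle (u := y) (v := x) (w := v)
  have h₂ := hG.dist_triangle (u := b) (v := y) (w := v)
  have h₃ := SimpleGraph.dist_eq_one_iff_adj.mpr hxy.symm
  simp only [interval, Set.mem_ofPred_eq] at hx ⊢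
  omega

theorem encard_descending_neighbors_le_two (hG : HereditaryModular G) {b v w : V}
    (hflat : K23Free (G.induce (interval G b v))) (hw : w ∈ interval G b v) :
    {x | x ∈ interval G b v ∧ G.Adj w x ∧ G.dist b x + 1 = G.dist b w}.encard ≤ 2 := by
  by_contra! hlt
  obtain ⟨T, hT, hT₃⟩ := Set.exists_subset_encard_eq (Order.add_one_le_of_lt hlt)
  obtain ⟨x₁, x₂, x₃, h₁₂, h₁₃, h₂₃, rfl⟩ := Set.encard_eq_three.mp (hT₃.trans two_add_one_eq_three)
  obtain ⟨hI₁, hw₁, hd₁⟩ := hT (show x₁ ∈ _ by simp)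
  obtain ⟨hI₂, hw₂, hd₂⟩ := hT (show x₂ ∈ _ by simp)
  obtain ⟨hI₃, hw₃, hd₃⟩ := hT (show x₃ ∈ _ by simp)
  have hM := hG.modular
  have key : ∀ y, G.Adj x₁ y → G.Adj x₂ y → G.Adj x₃ y → G.dist b y + 1 ≠ G.dist b x₁ := by
    intro y h₁ h₂ h₃ hy
    have hyI := mem_interval_of_adj hG.1 hI₁ h₁ hy
    refine hflat ⟨⟨w, hw⟩, ⟨y, hyI⟩, ⟨x₁, hI₁⟩, ⟨x₂, hI₂⟩, ⟨x₃, hI₃⟩, ?_, ?_, ?_, ?_,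
      hw₁, hw₂, hw₃, h₁.symm, h₂.symm, h₃.symm⟩
    · intro h
      obtain rfl : w = y := congrArg Subtype.val h
      omega
    all_goals simpa
  obtain ⟨a, h₂a, h₃a, ha⟩ := hM.exists_adj_adj_dist_add_one (b := b) hw₂ hw₃ h₂₃ (by omega)
  obtain ⟨c, h₁c, h₂c, hc⟩ := hM.exists_adj_adj_dist_add_one (b := b) hw₁ hw₂ h₁₂ (by omega)
  obtain ⟨e, h₁e, h₃e, he⟩ := hM.exists_adj_adj_dist_add_one (b := b) hw₁ hw₃ h₁₃ (by omega)
  have hae : a ≠ e := by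
    rintro rfl
    exact key a h₁e h₂a h₃a he
  have hac : a ≠ c := by
    rintro rfl
    exact key a h₁c h₂a h₃a hc
  have hec : e ≠ c := by
    rintro rfl
    exact key e h₁e h₂c h₃e he
  rcases hG.exists_chord_of_six_cycle h₁₂ h₁₃ h₂₃ hae hac hec h₁e h₁c h₂a h₂c h₃a h₃e with h | h | h
  · exact key a h h₂a h₃a (by omega)
  · exact key e h₁e h h₃e he
  · exact key c h₁c h₂c h hc

end

/-- In a hereditary modular graph with a `K_{2,3}`-free interval `I(b,v)`, every vertex
`w ∈ I(b,v)` other than `b` satisfies `1 ≤ ρ(w) ≤ 2`. -/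
theorem rho_bounds {V : Type*} (G : SimpleGraph V)
    (hG : HereditaryModular G) (b v : V)
    (hflat : K23Free (G.induce (interval G b v))) (w : V)
    (hw : w ∈ interval G b v) (hwb : w ≠ b) :
    1 ≤ rho G b v w ∧ rho G b v w ≤ 2 := by
  have hle := encard_descending_neighbors_le_two hG hflat hw
  have hfin := Set.finite_of_encard_le_coe (k := 2) hle
  constructor
  · obtain ⟨x, hwx, hx⟩ := hG.1.exists_adj_dist_add_one hwb
    rw [G.dist_comm, G.dist_comm (u := w)] at hx
    exact (Set.ncard_pos hfin).mpr ⟨x, mem_interval_of_adj hG.1 hw hwx hx, hwx, hx⟩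
  · rw [← hfin.cast_ncard_eq] at hle
    exact_mod_cast hle
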